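/- Let X be a random vector in ℝⁿ with E‖X‖² < ∞, M an independent standard Gaussian in ℝⁿ, and σ > 0 fixed. Apply the discretization t_{σ,a} independently to each coordinate of X, yielding a finitely supported distribution t^n_{σ,a}(X) on the grid. Then H(t^n_{σ,a}(X)) = n log a + D(X + σM) + o(1) as a → ∞, where H is Shannon entropy and D is differential entropy. -/

import Mathlib

open MeasureTheory ProbabilityTheory Real Filter

/-- `discProbVec n σ a μ r` is the probability that the coordinatewise randomized
discretization `t^n_{σ,a}(X)` of a random vector `X` with law `μ` equals the grid point
`(rᵢ/a)ᵢ`: independent `N(0,σ²)` noise is added in every coordinate, each coordinate is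
clamped to `[−a, a]` and rounded stochastically to the two nearest points of `(1/a)ℤ`. -/
noncomputable def discProbVec (n : ℕ) (σ : ℝ) (a : ℕ) (μ : Measure (Fin n → ℝ))
    (r : Fin n → ℤ) : ℝ :=
  ∫ x, ∫ g, ∏ i, max 0 (1 - |(max (-(a : ℝ)) (min (a : ℝ) (x i + σ * g i))) * a - (r i : ℝ)|)
    ∂(Measure.pi fun _ : Fin n => gaussianReal 0 1) ∂μ

/-- The density of `X + σM`, where `X` has law `μ` and `M` is an independent standard
Gaussian vector in `ℝⁿ`. -/
noncomputable def heatedDensity (n : ℕ) (σ : ℝ) (μ : Measure (Fin n → ℝ))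
    (y : Fin n → ℝ) : ℝ :=
  ∫ x, (2 * π * σ ^ 2) ^ (-(n : ℝ) / 2) * Real.exp (-(∑ i, (y i - x i) ^ 2) / (2 * σ ^ 2)) ∂μ

section GaussianKernel

variable {n : ℕ}

/-- The unnormalized centered Gaussian kernel `exp (-c ‖u‖²)` on `ℝⁿ`. -/
noncomputable def gaussKernel (n : ℕ) (c : ℝ) (u : Fin n → ℝ) : ℝ :=
  Real.exp (-(c * ∑ i, (u i) ^ 2))

lemma gaussKernel_pos (c : ℝ) (u : Fin n → ℝ) : 0 < gaussKernel n c u := Real.exp_pos _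

lemma gaussKernel_le_one {c : ℝ} (hc : 0 ≤ c) (u : Fin n → ℝ) : gaussKernel n c u ≤ 1 :=
  Real.exp_le_one_iff.2 (neg_nonpos.2 (by positivity))

@[fun_prop]
lemma continuous_gaussKernel (c : ℝ) : Continuous (gaussKernel n c) := by
  unfold gaussKernel; fun_prop

lemma gaussKernel_eq_prod (c : ℝ) (u : Fin n → ℝ) :
    gaussKernel n c u = ∏ i, Real.exp (-c * (u i) ^ 2) := by
  rw [gaussKernel, ← Real.exp_sum, Finset.mul_sum, ← Finset.sum_neg_distrib]
  simp

lemma integrable_gaussKernel {c : ℝ} (hc : 0 < c) : Integrable (gaussKernel n c) := by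
  simp_rw [funext (gaussKernel_eq_prod (n := n) c)]
  exact Integrable.fintype_prod (f := fun _ t => Real.exp (-c * t ^ 2))
    fun _ => integrable_exp_neg_mul_sq hc

lemma integrable_gaussKernel_mul_sum_sq {c : ℝ} (hc : 0 < c) :
    Integrable (fun u : Fin n → ℝ => gaussKernel n c u * ∑ i, (u i) ^ 2) := by
  refine ((integrable_gaussKernel (n := n) (half_pos hc)).const_mul (2 / c)).mono'
    (by fun_prop) (ae_of_all _ fun u => ?_)
  have hS : 0 ≤ ∑ i, (u i) ^ 2 := by positivity
  rw [Real.norm_of_nonneg (mul_nonneg (gaussKernel_pos _ _).le hS)]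
  have h1 : gaussKernel n c u = gaussKernel n (c / 2) u * gaussKernel n (c / 2) u := by
    simp only [gaussKernel, ← Real.exp_add]; ring_nf
  have h2 : gaussKernel n (c / 2) u * Real.exp (c / 2 * ∑ i, (u i) ^ 2) = 1 := by
    simp [gaussKernel, ← Real.exp_add]
  have h3 := Real.add_one_le_exp (c / 2 * ∑ i, (u i) ^ 2)
  have hp := gaussKernel_pos (c / 2) u
  have h4 : gaussKernel n (c / 2) u * (c / 2 * ∑ i, (u i) ^ 2) ≤ 1 := by
    rw [← h2]; gcongr; linarith
  have h5 : gaussKernel n (c / 2) u * ∑ i, (u i) ^ 2 ≤ 2 / c := by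
    rw [le_div_iff₀ hc]; linarith
  calc _ = (gaussKernel n (c / 2) u * ∑ i, (u i) ^ 2) * gaussKernel n (c / 2) u := by
        rw [h1]; ring
    _ ≤ _ := by gcongr

/-- The convolution of a measure with an unnormalized Gaussian kernel. -/
noncomputable def gaussSmoothing (n : ℕ) (c : ℝ) (μ : Measure (Fin n → ℝ)) (y : Fin n → ℝ) : ℝ :=
  ∫ x, gaussKernel n c (y - x) ∂μ

variable {μ : Measure (Fin n → ℝ)} {c : ℝ}

lemma gaussSmoothing_nonneg (y : Fin n → ℝ) : 0 ≤ gaussSmoothing n c μ y :=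
  integral_nonneg fun _ => (gaussKernel_pos _ _).le

variable [IsProbabilityMeasure μ]

lemma integrable_gaussKernel_sub (hc : 0 ≤ c) (y : Fin n → ℝ) :
    Integrable (fun x => gaussKernel n c (y - x)) μ := by
  refine (integrable_const (1 : ℝ)).mono' ?_ (ae_of_all _ fun x => ?_)
  · exact Continuous.aestronglyMeasurable (by fun_prop)
  · rw [Real.norm_of_nonneg (gaussKernel_pos _ _).le]
    exact gaussKernel_le_one hc _

lemma gaussSmoothing_le_one (hc : 0 ≤ c) (y : Fin n → ℝ) : gaussSmoothing n c μ y ≤ 1 := by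
  calc gaussSmoothing n c μ y ≤ ∫ _, (1 : ℝ) ∂μ :=
        integral_mono (integrable_gaussKernel_sub hc y) (integrable_const _)
          fun _ => gaussKernel_le_one hc _
    _ = 1 := by simp

lemma continuous_gaussSmoothing (hc : 0 ≤ c) : Continuous (gaussSmoothing n c μ) := by
  refine continuous_of_dominated (bound := fun _ => 1) (fun y => ?_) (fun y => ae_of_all _ fun x => ?_)
    (integrable_const _) (ae_of_all _ fun x => by fun_prop)
  · exact Continuous.aestronglyMeasurable (by fun_prop)
  · rw [Real.norm_of_nonneg (gaussKernel_pos _ _).le]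
    exact gaussKernel_le_one hc _

lemma integrable_prod_gaussKernel_sub_mul (hc : 0 < c)
    (hvar : Integrable (fun x : Fin n → ℝ => ∑ i, (x i) ^ 2) μ) (L : ℝ) :
    Integrable (fun p : (Fin n → ℝ) × (Fin n → ℝ) =>
      gaussKernel n c (p.2 - p.1) * (L + ∑ i, (p.2 i) ^ 2)) (μ.prod volume) := by
  have hmp := measurePreserving_prod_add μ (volume : Measure (Fin n → ℝ))
  rw [← hmp.integrable_comp (Continuous.aestronglyMeasurable (by fun_prop))]
  have hK := integrable_gaussKernel (n := n) hc
  have hKS := integrable_gaussKernel_mul_sum_sq (n := n) hc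
  have h1 : Integrable (fun p : (Fin n → ℝ) × (Fin n → ℝ) => (|L| : ℝ) * gaussKernel n c p.2)
      (μ.prod volume) := (integrable_const (|L| : ℝ)).mul_prod hK
  have h2 : Integrable (fun p : (Fin n → ℝ) × (Fin n → ℝ) =>
      (∑ i, (p.1 i) ^ 2) * gaussKernel n c p.2) (μ.prod volume) := hvar.mul_prod hK
  have h3 : Integrable (fun p : (Fin n → ℝ) × (Fin n → ℝ) =>
      (1 : ℝ) * (gaussKernel n c p.2 * ∑ i, (p.2 i) ^ 2)) (μ.prod volume) :=
    (integrable_const (1 : ℝ)).mul_prod hKS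
  refine (h1.add ((h2.add h3).const_mul 2)).mono'
    (Continuous.aestronglyMeasurable (by fun_prop)) (ae_of_all _ fun p => ?_)
  have hs : ∑ i, (p.1 i + p.2 i) ^ 2 ≤ 2 * ((∑ i, (p.1 i) ^ 2) + ∑ i, (p.2 i) ^ 2) := by
    rw [← Finset.sum_add_distrib, Finset.mul_sum]
    exact Finset.sum_le_sum fun i _ => by nlinarith [sq_nonneg (p.1 i - p.2 i)]
  have hs0 : 0 ≤ ∑ i, (p.1 i + p.2 i) ^ 2 := by positivity
  simp only [Function.comp, add_sub_cancel_left, Pi.add_apply, norm_mul,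
    Real.norm_of_nonneg (gaussKernel_pos _ _).le]
  calc gaussKernel n c p.2 * ‖L + ∑ i, (p.1 i + p.2 i) ^ 2‖
      ≤ gaussKernel n c p.2 * (|L| + 2 * ((∑ i, (p.1 i) ^ 2) + ∑ i, (p.2 i) ^ 2)) := by
        refine mul_le_mul_of_nonneg_left ?_ (gaussKernel_pos _ _).le
        refine (norm_add_le _ _).trans ?_
        rw [Real.norm_of_nonneg hs0, Real.norm_eq_abs]
        linarith
    _ = _ := by ring

lemma integrable_gaussSmoothing_mul (hc : 0 < c)
    (hvar : Integrable (fun x : Fin n → ℝ => ∑ i, (x i) ^ 2) μ) (L : ℝ) :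
    Integrable (fun y => gaussSmoothing n c μ y * (L + ∑ i, (y i) ^ 2)) := by
  have := (integrable_prod_gaussKernel_sub_mul hc hvar L).integral_prod_right
  simpa only [integral_mul_const, gaussSmoothing] using this

lemma gaussSmoothing_le_of_near (hc : 0 < c) {y z : Fin n → ℝ} (h : ∀ i, |z i - y i| ≤ 2) :
    gaussSmoothing n c μ z ≤ Real.exp (c * (n * 4)) * gaussSmoothing n (c / 2) μ y := by
  unfold gaussSmoothing
  rw [← integral_const_mul]
  refine integral_mono (integrable_gaussKernel_sub hc.le z)
    ((integrable_gaussKernel_sub (half_pos hc).le y).const_mul _) fun x => ?_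
  simp only [gaussKernel, ← Real.exp_add, Pi.sub_apply]
  refine Real.exp_le_exp.2 ?_
  have : ∑ i, (y i - x i) ^ 2 ≤ ∑ i, (2 * (z i - x i) ^ 2 + 8) :=
    Finset.sum_le_sum fun i _ => by
      have := sq_le_sq' (by linarith [neg_le_of_abs_le (h i)]) (le_of_abs_le (h i))
      nlinarith [sq_nonneg ((z i - x i) + (z i - y i))]
  rw [Finset.sum_add_distrib, ← Finset.mul_sum] at this
  simp at this
  nlinarith

end GaussianKernel

section HeatedDensity

variable {n : ℕ} {σ : ℝ} {μ : Measure (Fin n → ℝ)}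

lemma heatedDensity_eq (y : Fin n → ℝ) :
    heatedDensity n σ μ y =
      (2 * π * σ ^ 2) ^ (-(n : ℝ) / 2) * gaussSmoothing n (1 / (2 * σ ^ 2)) μ y := by
  unfold heatedDensity gaussSmoothing
  rw [← integral_const_mul]
  refine integral_congr_ae (ae_of_all _ fun x => ?_)
  simp only [gaussKernel, Pi.sub_apply]
  congr 2
  ring

lemma heatedDensity_nonneg (y : Fin n → ℝ) : 0 ≤ heatedDensity n σ μ y := by
  rw [heatedDensity_eq]
  exact mul_nonneg (by positivity) (gaussSmoothing_nonneg y)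

lemma pi_gaussianReal_eq_withDensity (m : Fin n → ℝ) {v : NNReal} (hv : v ≠ 0) :
    Measure.pi (fun i => gaussianReal (m i) v) =
      (volume : Measure (Fin n → ℝ)).withDensity
        fun y => ENNReal.ofReal (∏ i, gaussianPDFReal (m i) v (y i)) := by
  refine Measure.pi_eq fun s hs => ?_
  rw [withDensity_apply _ (MeasurableSet.univ_pi hs), volume_pi, Measure.restrict_pi_pi,
    ← ofReal_integral_eq_lintegral_ofReal, integral_fintype_prod_eq_prod
      (f := fun i t => gaussianPDFReal (m i) v t), ENNReal.ofReal_prod_of_nonneg]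
  · refine Finset.prod_congr rfl fun i _ => ?_
    rw [gaussianReal_apply_eq_integral _ hv]
  · exact fun i _ => integral_nonneg (gaussianPDFReal_nonneg _ _)
  · exact Integrable.fintype_prod (f := fun i t => gaussianPDFReal (m i) v t)
      fun i => (integrable_gaussianPDFReal _ _).integrableOn
  · exact ae_of_all _ fun y => Finset.prod_nonneg fun i _ => gaussianPDFReal_nonneg _ _ _

lemma integral_pi_gaussianReal_comp_affine (hσ : 0 < σ) (x : Fin n → ℝ) {H : (Fin n → ℝ) → ℝ}
    (hH : Continuous H) :
    ∫ g, H (fun i => x i + σ * g i) ∂(Measure.pi fun _ : Fin n => gaussianReal 0 1) =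
      ∫ y, (2 * π * σ ^ 2) ^ (-(n : ℝ) / 2) * gaussKernel n (1 / (2 * σ ^ 2)) (y - x) * H y := by
  obtain ⟨v, hvσ⟩ : ∃ v : NNReal, (v : ℝ) = σ ^ 2 := ⟨NNReal.mk (σ ^ 2) (sq_nonneg σ), rfl⟩
  have hv : v ≠ 0 := by
    rintro rfl
    rw [NNReal.coe_zero] at hvσ
    exact (pow_pos hσ 2).ne hvσ
  have hmap : (Measure.pi fun _ : Fin n => gaussianReal 0 1).map (fun g i => x i + σ * g i) =
      Measure.pi (fun i => gaussianReal (x i) v) := by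
    rw [Measure.pi_map_pi (f := fun i t => x i + σ * t)]
    · congr 1
      funext i
      have : (fun t : ℝ => x i + σ * t) = (fun t => x i + t) ∘ (fun t => σ * t) := rfl
      rw [this, ← Measure.map_map (by fun_prop) (by fun_prop), gaussianReal_map_const_mul,
        gaussianReal_map_const_add]
      congr 1
      · simp
      · ext; simp [hvσ]
    · exact fun i => by fun_prop
  rw [← integral_map (f := H) (φ := fun (g : Fin n → ℝ) i => x i + σ * g i)
    (Measurable.aemeasurable (by fun_prop))
    hH.aestronglyMeasurable, hmap, pi_gaussianReal_eq_withDensity _ hv,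
    integral_withDensity_eq_integral_toReal_smul]
  · refine integral_congr_ae (ae_of_all _ fun y => ?_)
    simp only [smul_eq_mul]
    congr 1
    rw [ENNReal.toReal_ofReal (Finset.prod_nonneg fun i _ => gaussianPDFReal_nonneg _ _ _)]
    simp only [gaussianPDFReal, Finset.prod_mul_distrib, gaussKernel, ← Real.exp_sum]
    congr 1
    · simp only [hvσ, Finset.prod_const, Finset.card_univ, Fintype.card_fin]
      rw [Real.sqrt_eq_rpow, ← Real.rpow_neg (by positivity), ← Real.rpow_natCast,
        ← Real.rpow_mul (by positivity)]
      congr 1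
      ring
    · congr 1
      simp only [Pi.sub_apply, Finset.mul_sum, ← Finset.sum_neg_distrib, hvσ]
      exact Finset.sum_congr rfl fun _ _ => by ring
  · refine Measurable.ennreal_ofReal (Finset.measurable_prod _ fun i _ => ?_)
    exact (measurable_gaussianPDFReal _ _).comp (measurable_pi_apply i)
  · simp

variable [IsProbabilityMeasure μ]

lemma integral_integral_gaussian_eq (hσ : 0 < σ)
    (hvar : Integrable (fun x : Fin n → ℝ => ∑ i, (x i) ^ 2) μ) {H : (Fin n → ℝ) → ℝ}
    (hH : Continuous H) (hH1 : ∀ y, |H y| ≤ 1) :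
    ∫ x, ∫ g, H (fun i => x i + σ * g i) ∂(Measure.pi fun _ : Fin n => gaussianReal 0 1) ∂μ =
      ∫ y, heatedDensity n σ μ y * H y := by
  simp_rw [fun x => integral_pi_gaussianReal_comp_affine hσ x hH]
  rw [integral_integral_swap]
  · refine integral_congr_ae (ae_of_all _ fun y => ?_)
    simp only [heatedDensity_eq, gaussSmoothing]
    rw [integral_mul_const, integral_const_mul]
  · refine ((integrable_prod_gaussKernel_sub_mul (c := 1 / (2 * σ ^ 2)) (by positivity)
      hvar 1).const_mul ((2 * π * σ ^ 2) ^ (-(n : ℝ) / 2))).mono'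
      (Continuous.aestronglyMeasurable (by simp only [Function.uncurry_def]; fun_prop))
      (ae_of_all _ fun p => ?_)
    simp only [Function.uncurry_def, norm_mul, Real.norm_of_nonneg (gaussKernel_pos _ _).le]
    rw [Real.norm_of_nonneg (by positivity), mul_assoc]
    have := gaussKernel_pos (1 / (2 * σ ^ 2)) (p.2 - p.1)
    gcongr
    exact (hH1 p.2).trans (le_add_of_nonneg_right (by positivity))

lemma continuous_heatedDensity : Continuous (heatedDensity n σ μ) := by
  simp_rw [funext (heatedDensity_eq (n := n) (σ := σ) (μ := μ))]
  exact continuous_const.mul (continuous_gaussSmoothing (by positivity))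

lemma integrable_heatedDensity_mul (hσ : 0 < σ)
    (hvar : Integrable (fun x : Fin n → ℝ => ∑ i, (x i) ^ 2) μ) (L : ℝ) :
    Integrable (fun y => heatedDensity n σ μ y * (L + ∑ i, (y i) ^ 2)) := by
  simp_rw [heatedDensity_eq, mul_assoc]
  exact (integrable_gaussSmoothing_mul (by positivity) hvar L).const_mul _

lemma integral_heatedDensity (hσ : 0 < σ)
    (hvar : Integrable (fun x : Fin n → ℝ => ∑ i, (x i) ^ 2) μ) :
    ∫ y, heatedDensity n σ μ y = 1 := by
  have := integral_integral_gaussian_eq (μ := μ) hσ hvar (H := fun _ => 1) continuous_const (by simp)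
  simpa using this.symm

end HeatedDensity

section Tent

/-- The tent function, giving the probability that stochastic rounding of `t` yields `0`. -/
noncomputable def tent (t : ℝ) : ℝ := max 0 (1 - |t|)

lemma tent_nonneg (t : ℝ) : 0 ≤ tent t := le_max_left _ _

lemma tent_le_one (t : ℝ) : tent t ≤ 1 := max_le zero_le_one (by linarith [abs_nonneg t])

@[fun_prop]
lemma continuous_tent : Continuous tent := by unfold tent; fun_prop

lemma tent_eq_zero {t : ℝ} (h : 1 ≤ |t|) : tent t = 0 := max_eq_left (by linarith)

lemma abs_lt_one_of_tent_ne_zero {t : ℝ} (h : tent t ≠ 0) : |t| < 1 := by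
  contrapose! h
  exact tent_eq_zero h

lemma hasCompactSupport_tent : HasCompactSupport tent :=
  HasCompactSupport.intro (isCompact_Icc (a := (-1 : ℝ)) (b := 1)) fun t ht =>
    tent_eq_zero (by
      by_contra h
      have := abs_lt.1 (not_le.1 h)
      exact ht ⟨this.1.le, this.2.le⟩)

lemma integrable_tent : Integrable tent :=
  continuous_tent.integrable_of_hasCompactSupport hasCompactSupport_tent

lemma integral_tent : ∫ t, tent t = 1 := by
  have h1 : ∫ t in Set.Ioc (-1 : ℝ) 1, tent t = ∫ t, tent t := by
    refine setIntegral_eq_integral_of_forall_compl_eq_zero fun t ht => tent_eq_zero ?_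
    by_contra h
    have := abs_lt.1 (not_le.1 h)
    exact ht ⟨this.1, this.2.le⟩
  have hi : ∀ x y : ℝ, IntervalIntegrable tent volume x y :=
    fun x y => continuous_tent.intervalIntegrable x y
  rw [← h1, ← intervalIntegral.integral_of_le (by norm_num),
    ← intervalIntegral.integral_add_adjacent_intervals (hi (-1) 0) (hi 0 1)]
  have h2 : ∫ t in (-1 : ℝ)..0, tent t = ∫ t in (-1 : ℝ)..0, (1 + t) := by
    refine intervalIntegral.integral_congr fun t ht => ?_
    rw [Set.uIcc_of_le (by norm_num)] at ht
    simp only [tent, abs_of_nonpos ht.2]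
    rw [max_eq_right] <;> linarith [ht.1]
  have h3 : ∫ t in (0 : ℝ)..1, tent t = ∫ t in (0 : ℝ)..1, (1 - t) := by
    refine intervalIntegral.integral_congr fun t ht => ?_
    rw [Set.uIcc_of_le (by norm_num)] at ht
    simp only [tent, abs_of_nonneg ht.1]
    exact max_eq_right (by linarith [ht.2])
  rw [h2, h3, intervalIntegral.integral_add, intervalIntegral.integral_sub] <;>
    norm_num

lemma sum_tent_sub_intCast {A : ℤ} {t : ℝ} (h1 : -(A : ℝ) ≤ t) (h2 : t ≤ A) :
    ∑ k ∈ Finset.Icc (-A) A, tent (t - k) = 1 := by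
  have e1 : ∑ k ∈ Finset.Icc (-A) A, tent (t - k) =
      ∑ k ∈ Finset.Icc (-A) (A + 1), tent (t - k) := by
    refine Finset.sum_subset (Finset.Icc_subset_Icc_right (by lia)) fun k hk hk' => ?_
    have : k = A + 1 := by simp only [Finset.mem_Icc] at hk hk'; lia
    subst this
    refine tent_eq_zero ?_
    push_cast
    rw [abs_of_nonpos] <;> linarith
  have e2 : ∑ k ∈ ({⌊t⌋, ⌊t⌋ + 1} : Finset ℤ), tent (t - k) =
      ∑ k ∈ Finset.Icc (-A) (A + 1), tent (t - k) := by
    refine Finset.sum_subset (fun k hk => ?_) fun k hk hk' => ?_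
    · have l1 : -A ≤ ⌊t⌋ := Int.le_floor.2 (by push_cast; exact h1)
      have l2 : ⌊t⌋ ≤ A := by exact_mod_cast (Int.floor_le t).trans h2
      simp only [Finset.mem_insert, Finset.mem_singleton] at hk
      simp only [Finset.mem_Icc]
      lia
    · simp only [Finset.mem_insert, Finset.mem_singleton, not_or] at hk'
      refine tent_eq_zero ?_
      rcases lt_or_ge k ⌊t⌋ with h | h
      · have : (k : ℝ) + 1 ≤ ⌊t⌋ := by exact_mod_cast h
        rw [abs_of_nonneg] <;> linarith [Int.floor_le t]
      · have : (⌊t⌋ : ℝ) + 2 ≤ k := by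
          have : ⌊t⌋ + 2 ≤ k := by lia
          exact_mod_cast this
        rw [abs_of_nonpos] <;> linarith [Int.lt_floor_add_one t]
  rw [e1, ← e2, Finset.sum_pair (by lia)]
  have f1 := Int.floor_le t
  have f2 := Int.lt_floor_add_one t
  simp only [tent]
  push_cast
  rw [abs_of_nonneg (by linarith), abs_of_nonpos (by linarith), max_eq_right (by linarith),
    max_eq_right (by linarith)]
  ring

end Tent

section Grid

variable {n : ℕ}

/-- Indices of the grid points in the cube `[-a, a]ⁿ`. -/
noncomputable def gridIndices (n a : ℕ) : Finset (Fin n → ℤ) :=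
  Fintype.piFinset fun _ => Finset.Icc (-((a : ℤ) * a)) (a * a)

/-- Indices of the grid points in the open cube `(-a, a)ⁿ`. -/
noncomputable def interiorIndices (n a : ℕ) : Finset (Fin n → ℤ) :=
  Fintype.piFinset fun _ => Finset.Ioo (-((a : ℤ) * a)) (a * a)

lemma interiorIndices_subset (n a : ℕ) : interiorIndices n a ⊆ gridIndices n a :=
  Fintype.piFinset_subset _ _ fun _ => Finset.Ioo_subset_Icc_self

/-- The probability that clamping and stochastic rounding sends `y` to the grid point `r / a`. -/
noncomputable def roundingWeight (a : ℕ) (r : Fin n → ℤ) (y : Fin n → ℝ) : ℝ :=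
  ∏ i, tent (max (-(a : ℝ)) (min (a : ℝ) (y i)) * a - r i)

lemma roundingWeight_nonneg (a : ℕ) (r : Fin n → ℤ) (y : Fin n → ℝ) : 0 ≤ roundingWeight a r y :=
  Finset.prod_nonneg fun _ _ => tent_nonneg _

lemma roundingWeight_le_one (a : ℕ) (r : Fin n → ℤ) (y : Fin n → ℝ) : roundingWeight a r y ≤ 1 :=
  Finset.prod_le_one (fun _ _ => tent_nonneg _) fun _ _ => tent_le_one _

@[fun_prop]
lemma continuous_roundingWeight (a : ℕ) (r : Fin n → ℤ) : Continuous (roundingWeight a r) := by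
  unfold roundingWeight; fun_prop

lemma clamp_mul_mem (a : ℕ) (t : ℝ) :
    -(((a : ℤ) * a : ℤ) : ℝ) ≤ max (-(a : ℝ)) (min (a : ℝ) t) * a ∧
      max (-(a : ℝ)) (min (a : ℝ) t) * a ≤ (((a : ℤ) * a : ℤ) : ℝ) := by
  have ha : (0 : ℝ) ≤ a := a.cast_nonneg
  have h1 : -(a : ℝ) ≤ max (-(a : ℝ)) (min (a : ℝ) t) := le_max_left _ _
  have h2 : max (-(a : ℝ)) (min (a : ℝ) t) ≤ a := max_le (by linarith) (min_le_left _ _)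
  push_cast
  constructor <;> nlinarith

lemma sum_roundingWeight (a : ℕ) (y : Fin n → ℝ) :
    ∑ r ∈ gridIndices n a, roundingWeight a r y = 1 := by
  unfold gridIndices roundingWeight
  rw [← Finset.prod_univ_sum (fun _ => Finset.Icc (-((a : ℤ) * a)) (a * a))
    (fun i k => tent (max (-(a : ℝ)) (min (a : ℝ) (y i)) * a - (k : ℤ)))]
  exact Finset.prod_eq_one fun i _ => sum_tent_sub_intCast (clamp_mul_mem a _).1 (clamp_mul_mem a _).2

lemma roundingWeight_eq_zero {a : ℕ} {r : Fin n → ℤ} (hr : r ∉ gridIndices n a) (y : Fin n → ℝ) :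
    roundingWeight a r y = 0 := by
  simp only [gridIndices, Fintype.mem_piFinset, not_forall] at hr
  obtain ⟨i, hi⟩ := hr
  refine Finset.prod_eq_zero (Finset.mem_univ i) (tent_eq_zero ?_)
  obtain ⟨h1, h2⟩ := clamp_mul_mem a (y i)
  have : r i + 1 ≤ -((a : ℤ) * a) ∨ (a : ℤ) * a + 1 ≤ r i := by
    simp only [Finset.mem_Icc] at hi; lia
  rcases this with h | h
  · have : (r i : ℝ) + 1 ≤ -(((a : ℤ) * a : ℤ) : ℝ) := by exact_mod_cast h
    rw [abs_of_nonneg] <;> linarith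
  · have : (((a : ℤ) * a : ℤ) : ℝ) + 1 ≤ r i := by exact_mod_cast h
    rw [abs_of_nonpos] <;> linarith

lemma roundingWeight_interior {a : ℕ} (ha : 0 < a) {r : Fin n → ℤ} (hr : r ∈ interiorIndices n a)
    (y : Fin n → ℝ) : roundingWeight a r y = ∏ i, tent (a * y i - r i) := by
  refine Finset.prod_congr rfl fun i _ => ?_
  have hi := Fintype.mem_piFinset.1 hr i
  simp only [Finset.mem_Ioo] at hi
  have h1 : -((a : ℝ) * a) + 1 ≤ r i := by exact_mod_cast hi.1
  have h2 : (r i : ℝ) + 1 ≤ a * a := by exact_mod_cast hi.2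
  have ha' : (0 : ℝ) < a := by exact_mod_cast ha
  rcases le_or_gt (a : ℝ) (y i) with h | h
  · rw [min_eq_left h, max_eq_right (by linarith), tent_eq_zero, tent_eq_zero]
    · rw [abs_of_nonneg] <;> nlinarith
    · rw [abs_of_nonneg] <;> nlinarith
  rw [min_eq_right h.le]
  rcases le_or_gt (-(a : ℝ)) (y i) with h' | h'
  · rw [max_eq_right h', mul_comm]
  · rw [max_eq_left h'.le, tent_eq_zero, tent_eq_zero]
    · rw [abs_of_nonpos] <;> nlinarith
    · rw [abs_of_nonpos] <;> nlinarith

lemma roundingWeight_boundary_le {a : ℕ} (ha : 2 ≤ a) {r : Fin n → ℤ}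
    (hr : r ∈ gridIndices n a \ interiorIndices n a) (y : Fin n → ℝ) :
    roundingWeight a r y ≤ roundingWeight a r y * (4 / (a : ℝ) ^ 2 * ∑ i, (y i) ^ 2) := by
  rcases eq_or_ne (roundingWeight a r y) 0 with h0 | h0
  · simp [h0]
  refine le_mul_of_one_le_right (roundingWeight_nonneg a r y) ?_
  rw [Finset.mem_sdiff] at hr
  obtain ⟨hr1, hr2⟩ := hr
  simp only [interiorIndices, Fintype.mem_piFinset, not_forall] at hr2
  obtain ⟨i, hi⟩ := hr2
  have hi' := Fintype.mem_piFinset.1 hr1 i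
  have ht := abs_lt.1 (abs_lt_one_of_tent_ne_zero (Finset.prod_ne_zero_iff.1 h0 i (Finset.mem_univ i)))
  have ha' : (2 : ℝ) ≤ a := by exact_mod_cast ha
  have hor : r i = (a : ℤ) * a ∨ r i = -((a : ℤ) * a) := by
    simp only [Finset.mem_Ioo, Finset.mem_Icc] at hi hi'
    generalize (a : ℤ) * a = A at hi hi' ⊢
    lia
  have hy : (a : ℝ) / 2 ≤ |y i| := by
    rcases hor with h | h
    · have hc : (r i : ℝ) = a * a := by exact_mod_cast h
      rw [hc] at ht
      refine le_trans ?_ (le_abs_self _)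
      by_contra! hlt
      have : max (-(a : ℝ)) (min (a : ℝ) (y i)) ≤ a / 2 :=
        max_le (by linarith) ((min_le_right _ _).trans hlt.le)
      nlinarith
    · have hc : (r i : ℝ) = -((a : ℝ) * a) := by exact_mod_cast h
      rw [hc] at ht
      refine le_trans ?_ (neg_le_abs _)
      by_contra! hlt
      have : -((a : ℝ) / 2) ≤ max (-(a : ℝ)) (min (a : ℝ) (y i)) :=
        le_max_of_le_right (le_min (by linarith) (by linarith))
      nlinarith
  have hsq : (a : ℝ) ^ 2 / 4 ≤ (y i) ^ 2 := by
    rw [← sq_abs (y i)]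
    nlinarith
  have hle : (y i) ^ 2 ≤ ∑ i, (y i) ^ 2 :=
    Finset.single_le_sum (f := fun i => (y i) ^ 2) (fun _ _ => sq_nonneg _) (Finset.mem_univ i)
  rw [div_mul_eq_mul_div, le_div_iff₀ (by positivity)]
  linarith

lemma card_gridIndices (n a : ℕ) : (gridIndices n a).card = (2 * (a * a) + 1) ^ n := by
  unfold gridIndices
  rw [Fintype.card_piFinset_const, Int.card_Icc]
  congr 1
  lia

end Grid

section LocalAverage

variable {n : ℕ}

/-- The average of `f` near the grid point `r / a`, weighted by a product of tents of width
`1 / a`. -/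
noncomputable def tentAverage (f : (Fin n → ℝ) → ℝ) (a : ℕ) (r : Fin n → ℤ) : ℝ :=
  ∫ u : Fin n → ℝ, f (fun i => (r i + u i) / a) * ∏ i, tent (u i)

lemma integrable_prod_tent : Integrable (fun u : Fin n → ℝ => ∏ i, tent (u i)) :=
  Integrable.fintype_prod (f := fun _ t => tent t) fun _ => integrable_tent

lemma integral_prod_tent : ∫ u : Fin n → ℝ, ∏ i, tent (u i) = 1 := by
  rw [integral_fintype_prod_volume_eq_pow, integral_tent, one_pow]

lemma prod_tent_nonneg (u : Fin n → ℝ) : 0 ≤ ∏ i, tent (u i) :=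
  Finset.prod_nonneg fun _ _ => tent_nonneg _

lemma tentAverage_nonneg {f : (Fin n → ℝ) → ℝ} (hf : ∀ y, 0 ≤ f y) (a : ℕ) (r : Fin n → ℤ) :
    0 ≤ tentAverage f a r :=
  integral_nonneg fun _ => mul_nonneg (hf _) (prod_tent_nonneg _)

lemma integral_mul_prod_tent {a : ℕ} (ha : 0 < a) (f : (Fin n → ℝ) → ℝ) (r : Fin n → ℤ) :
    ∫ y, f y * ∏ i, tent (a * y i - r i) = ((a : ℝ) ^ n)⁻¹ * tentAverage f a r := by
  have ha' : (a : ℝ) ≠ 0 := by positivity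
  set G : (Fin n → ℝ) → ℝ := fun y => f y * ∏ i, tent (a * y i - r i)
  have h1 : tentAverage f a r = ∫ u : Fin n → ℝ, G ((a : ℝ)⁻¹ • ((fun i => (r i : ℝ)) + u)) := by
    refine integral_congr_ae (ae_of_all _ fun u => ?_)
    simp only [G, Pi.smul_apply, Pi.add_apply, smul_eq_mul, mul_inv_cancel_left₀ ha',
      add_sub_cancel_left]
    congr 2
    funext i
    simp [div_eq_inv_mul]
  rw [h1, integral_add_left_eq_self (fun v => G ((a : ℝ)⁻¹ • v)), Measure.integral_comp_smul]
  simp only [Module.finrank_fintype_fun_eq_card, Fintype.card_fin, smul_eq_mul]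
  rw [inv_pow, inv_inv, abs_of_nonneg (by positivity), inv_mul_cancel_left₀ (by positivity)]

lemma tentAverage_le {f : (Fin n → ℝ) → ℝ} (hf : ∀ y, 0 ≤ f y) {a : ℕ} (ha : 0 < a)
    {r : Fin n → ℤ} {y : Fin n → ℝ} (hr : ∀ i, |(r i : ℝ) - a * y i| ≤ 1) {B : ℝ}
    (hB : ∀ z : Fin n → ℝ, (∀ i, |z i - y i| ≤ 2) → f z ≤ B) :
    tentAverage f a r ≤ B := by
  have ha' : (1 : ℝ) ≤ a := by exact_mod_cast ha
  calc tentAverage f a r ≤ ∫ u : Fin n → ℝ, B * ∏ i, tent (u i) := by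
        refine integral_mono_of_nonneg
          (ae_of_all _ fun u => mul_nonneg (hf _) (prod_tent_nonneg _))
          (integrable_prod_tent.const_mul B) (ae_of_all _ fun u => ?_)
        by_cases h0 : ∏ i, tent (u i) = 0
        · simp [h0]
        refine mul_le_mul_of_nonneg_right (hB _ fun i => ?_) (prod_tent_nonneg u)
        have hu := abs_lt_one_of_tent_ne_zero (Finset.prod_ne_zero_iff.1 h0 i (Finset.mem_univ i))
        have : ((r i : ℝ) + u i) / a - y i = (((r i : ℝ) - a * y i) + u i) / a := by
          field_simp
          ring
        rw [this, abs_div, abs_of_pos (by linarith : (0 : ℝ) < a), div_le_iff₀ (by linarith)]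
        linarith [abs_add_le ((r i : ℝ) - a * y i) (u i), hr i]
    _ = B := by rw [integral_const_mul, integral_prod_tent, mul_one]

lemma abs_floor_sub_le (t : ℝ) : |(⌊t⌋ : ℝ) - t| ≤ 1 := by
  rw [abs_le]
  constructor <;> linarith [Int.floor_le t, Int.lt_floor_add_one t]

lemma tendsto_tentAverage {f : (Fin n → ℝ) → ℝ} (hf : Continuous f) {B : ℝ} (hB : ∀ y, |f y| ≤ B)
    (y : Fin n → ℝ) :
    Tendsto (fun a : ℕ => tentAverage f a fun i => ⌊(a : ℝ) * y i⌋) atTop (nhds (f y)) := by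
  have h1 : f y = ∫ u : Fin n → ℝ, f y * ∏ i, tent (u i) := by
    rw [integral_const_mul, integral_prod_tent, mul_one]
  rw [h1]
  refine tendsto_integral_of_dominated_convergence (fun u => B * ∏ i, tent (u i)) (fun a => ?_)
    (integrable_prod_tent.const_mul B) (fun a => ae_of_all _ fun u => ?_) (ae_of_all _ fun u => ?_)
  · exact Continuous.aestronglyMeasurable (by fun_prop)
  · rw [norm_mul, Real.norm_of_nonneg (prod_tent_nonneg u)]
    exact mul_le_mul_of_nonneg_right (hB _) (prod_tent_nonneg u)
  · refine Tendsto.mul_const _ ((hf.tendsto y).comp (tendsto_pi_nhds.2 fun i => ?_))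
    have hz : Tendsto (fun a : ℕ => (1 + |u i|) / (a : ℝ)) atTop (nhds 0) :=
      tendsto_const_nhds.div_atTop tendsto_natCast_atTop_atTop
    refine tendsto_iff_dist_tendsto_zero.2 (squeeze_zero' (Eventually.of_forall fun _ => dist_nonneg)
      ?_ hz)
    filter_upwards [eventually_gt_atTop 0] with a ha
    have ha' : (0 : ℝ) < a := by exact_mod_cast ha
    have : ((⌊(a : ℝ) * y i⌋ : ℝ) + u i) / a - y i =
        (((⌊(a : ℝ) * y i⌋ : ℝ) - a * y i) + u i) / a := by
      field_simp
      ring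
    rw [Real.dist_eq, this, abs_div, abs_of_pos ha']
    gcongr
    exact (abs_add_le _ _).trans (by gcongr; exact abs_floor_sub_le _)

lemma abs_negMulLog_le {t K : ℝ} (h0 : 0 ≤ t) (hK : t ≤ K) {S : ℝ} (hS : 0 ≤ S) :
    |negMulLog t| ≤ t * (K + S) + Real.exp (-S) := by
  rcases h0.eq_or_lt with rfl | ht
  · simpa using (Real.exp_pos _).le
  have h1 : Real.log t ≤ t - 1 := Real.log_le_sub_one_of_pos ht
  have h2 := Real.log_le_sub_one_of_pos (div_pos (Real.exp_pos (-S)) ht)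
  rw [Real.log_div (Real.exp_pos _).ne' ht.ne', Real.log_exp] at h2
  have h3 : t * (-S - Real.log t) ≤ Real.exp (-S) - t := by
    calc t * (-S - Real.log t) ≤ t * (Real.exp (-S) / t - 1) := by gcongr
      _ = _ := by field_simp
  have h4 : t * Real.log t ≤ t * K := by gcongr; linarith
  have := mul_nonneg h0 hS
  have := mul_nonneg h0 (h0.trans hK)
  have := Real.exp_pos (-S)
  rw [negMulLog, abs_le]
  constructor <;> nlinarith

lemma setOf_floor_eq {a : ℕ} (ha : 0 < a) (r : Fin n → ℤ) :
    {y : Fin n → ℝ | (fun i => ⌊(a : ℝ) * y i⌋) = r} =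
      Set.univ.pi fun i => Set.Ico ((r i : ℝ) / a) ((r i + 1) / a) := by
  have ha' : (0 : ℝ) < a := by exact_mod_cast ha
  ext y
  simp only [Set.mem_ofPred_eq, funext_iff, Set.mem_univ_pi, Set.mem_Ico, Int.floor_eq_iff,
    div_le_iff₀ ha', lt_div_iff₀ ha', mul_comm]

lemma integral_comp_floor {a : ℕ} (ha : 0 < a) (I : Finset (Fin n → ℤ)) (φ : (Fin n → ℤ) → ℝ) :
    ∫ y : Fin n → ℝ, (∑ r ∈ I, if (fun i => ⌊(a : ℝ) * y i⌋) = r then φ r else 0) =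
      ((a : ℝ) ^ n)⁻¹ * ∑ r ∈ I, φ r := by
  have ha' : (0 : ℝ) < a := by exact_mod_cast ha
  have hm : ∀ r : Fin n → ℤ, MeasurableSet {y : Fin n → ℝ | (fun i => ⌊(a : ℝ) * y i⌋) = r} := by
    intro r
    rw [setOf_floor_eq ha]
    exact MeasurableSet.univ_pi fun i => measurableSet_Ico
  have hv : ∀ r : Fin n → ℤ, volume {y : Fin n → ℝ | (fun i => ⌊(a : ℝ) * y i⌋) = r} =
      ENNReal.ofReal (((a : ℝ) ^ n)⁻¹) := by
    intro r
    rw [setOf_floor_eq ha, Real.volume_pi_Ico, ← ENNReal.ofReal_prod_of_nonneg]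
    · congr 1
      simp [← sub_div]
    · intro i _
      rw [← sub_div]
      simp
  have he : ∀ (r : Fin n → ℤ) (y : Fin n → ℝ),
      (if (fun i => ⌊(a : ℝ) * y i⌋) = r then φ r else 0) =
        {y : Fin n → ℝ | (fun i => ⌊(a : ℝ) * y i⌋) = r}.indicator (fun _ => φ r) y :=
    fun r y => by simp [Set.indicator]
  simp_rw [he]
  rw [integral_finsetSum, Finset.mul_sum]
  · refine Finset.sum_congr rfl fun r _ => ?_
    rw [integral_indicator_const _ (hm r), Measure.real, hv, ENNReal.toReal_ofReal (by positivity),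
      smul_eq_mul]
  · intro r _
    refine (integrable_indicator_iff (hm r)).2 (integrableOn_const ?_)
    rw [hv]
    exact ENNReal.ofReal_ne_top

lemma eventually_floor_mem_interiorIndices (y : Fin n → ℝ) :
    ∀ᶠ a : ℕ in atTop, (fun i => ⌊(a : ℝ) * y i⌋) ∈ interiorIndices n a := by
  have h : ∀ᶠ a : ℕ in atTop, ∀ i, |y i| + 1 < a :=
    eventually_all.2 fun i => tendsto_natCast_atTop_atTop.eventually_gt_atTop _
  filter_upwards [h, eventually_gt_atTop 0] with a hay ha
  have ha' : (1 : ℝ) ≤ a := by exact_mod_cast ha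
  refine Fintype.mem_piFinset.2 fun i => ?_
  have h1 := abs_lt.1 (show |y i| < a - 1 by linarith [hay i])
  rw [Finset.mem_Ioo]
  constructor
  · rw [← @Int.cast_lt ℝ]
    push_cast
    nlinarith [Int.lt_floor_add_one ((a : ℝ) * y i)]
  · rw [Int.floor_lt]
    push_cast
    nlinarith

end LocalAverage

section DiscretizedEntropy

variable {n : ℕ} {σ : ℝ} {μ : Measure (Fin n → ℝ)} [IsProbabilityMeasure μ]

lemma discProbVec_eq (hσ : 0 < σ) (hvar : Integrable (fun x : Fin n → ℝ => ∑ i, (x i) ^ 2) μ)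
    (a : ℕ) (r : Fin n → ℤ) :
    discProbVec n σ a μ r = ∫ y, heatedDensity n σ μ y * roundingWeight a r y :=
  integral_integral_gaussian_eq hσ hvar (continuous_roundingWeight a r) fun y => by
    rw [abs_of_nonneg (roundingWeight_nonneg a r y)]
    exact roundingWeight_le_one a r y

lemma integrable_heatedDensity (hσ : 0 < σ)
    (hvar : Integrable (fun x : Fin n → ℝ => ∑ i, (x i) ^ 2) μ) :
    Integrable (heatedDensity n σ μ) := by
  by_contra h
  simpa [integral_undef h] using integral_heatedDensity hσ hvar

lemma integrable_heatedDensity_mul_sum_sq (hσ : 0 < σ)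
    (hvar : Integrable (fun x : Fin n → ℝ => ∑ i, (x i) ^ 2) μ) :
    Integrable (fun y => heatedDensity n σ μ y * ∑ i, (y i) ^ 2) := by
  simpa using integrable_heatedDensity_mul hσ hvar 0

lemma integrable_heatedDensity_mul_roundingWeight (hσ : 0 < σ)
    (hvar : Integrable (fun x : Fin n → ℝ => ∑ i, (x i) ^ 2) μ) (a : ℕ) (r : Fin n → ℤ) :
    Integrable (fun y => heatedDensity n σ μ y * roundingWeight a r y) := by
  refine (integrable_heatedDensity hσ hvar).mono'
    (continuous_heatedDensity.mul (continuous_roundingWeight a r)).aestronglyMeasurable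
    (ae_of_all _ fun y => ?_)
  rw [Real.norm_of_nonneg (mul_nonneg (heatedDensity_nonneg y) (roundingWeight_nonneg a r y))]
  exact mul_le_of_le_one_right (heatedDensity_nonneg y) (roundingWeight_le_one a r y)

lemma sum_discProbVec (hσ : 0 < σ) (hvar : Integrable (fun x : Fin n → ℝ => ∑ i, (x i) ^ 2) μ)
    (a : ℕ) (B : Finset (Fin n → ℤ)) :
    ∑ r ∈ B, discProbVec n σ a μ r =
      ∫ y, heatedDensity n σ μ y * ∑ r ∈ B, roundingWeight a r y := by
  simp_rw [discProbVec_eq hσ hvar, Finset.mul_sum]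
  rw [integral_finsetSum]
  exact fun r _ => integrable_heatedDensity_mul_roundingWeight hσ hvar a r

lemma sum_discProbVec_gridIndices (hσ : 0 < σ)
    (hvar : Integrable (fun x : Fin n → ℝ => ∑ i, (x i) ^ 2) μ) (a : ℕ) :
    ∑ r ∈ gridIndices n a, discProbVec n σ a μ r = 1 := by
  simp_rw [sum_discProbVec hσ hvar, sum_roundingWeight, mul_one]
  exact integral_heatedDensity hσ hvar

lemma discProbVec_nonneg (hσ : 0 < σ) (hvar : Integrable (fun x : Fin n → ℝ => ∑ i, (x i) ^ 2) μ)
    (a : ℕ) (r : Fin n → ℤ) : 0 ≤ discProbVec n σ a μ r := by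
  rw [discProbVec_eq hσ hvar]
  exact integral_nonneg fun y => mul_nonneg (heatedDensity_nonneg y) (roundingWeight_nonneg a r y)

lemma discProbVec_eq_zero (hσ : 0 < σ) (hvar : Integrable (fun x : Fin n → ℝ => ∑ i, (x i) ^ 2) μ)
    {a : ℕ} {r : Fin n → ℤ} (hr : r ∉ gridIndices n a) : discProbVec n σ a μ r = 0 := by
  simp [discProbVec_eq hσ hvar, roundingWeight_eq_zero hr]

lemma discProbVec_le_one (hσ : 0 < σ) (hvar : Integrable (fun x : Fin n → ℝ => ∑ i, (x i) ^ 2) μ)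
    (a : ℕ) (r : Fin n → ℤ) : discProbVec n σ a μ r ≤ 1 := by
  by_cases hr : r ∈ gridIndices n a
  · rw [← sum_discProbVec_gridIndices hσ hvar a]
    exact Finset.single_le_sum (fun r _ => discProbVec_nonneg hσ hvar a r) hr
  · simp [discProbVec_eq_zero hσ hvar hr]

lemma discProbVec_interior (hσ : 0 < σ)
    (hvar : Integrable (fun x : Fin n → ℝ => ∑ i, (x i) ^ 2) μ) {a : ℕ} (ha : 0 < a)
    {r : Fin n → ℤ} (hr : r ∈ interiorIndices n a) :
    discProbVec n σ a μ r = ((a : ℝ) ^ n)⁻¹ * tentAverage (heatedDensity n σ μ) a r := by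
  simp_rw [discProbVec_eq hσ hvar, roundingWeight_interior ha hr]
  exact integral_mul_prod_tent ha _ r

lemma sum_discProbVec_boundary_le (hσ : 0 < σ)
    (hvar : Integrable (fun x : Fin n → ℝ => ∑ i, (x i) ^ 2) μ) {a : ℕ} (ha : 2 ≤ a) :
    ∑ r ∈ gridIndices n a \ interiorIndices n a, discProbVec n σ a μ r ≤
      4 / (a : ℝ) ^ 2 * ∫ y, heatedDensity n σ μ y * ∑ i, (y i) ^ 2 := by
  rw [sum_discProbVec hσ hvar, ← integral_const_mul]
  refine integral_mono_of_nonneg (ae_of_all _ fun y => mul_nonneg (heatedDensity_nonneg y)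
    (Finset.sum_nonneg fun r _ => roundingWeight_nonneg a r y))
    ((integrable_heatedDensity_mul_sum_sq hσ hvar).const_mul _) (ae_of_all _ fun y => ?_)
  have h1 : ∑ r ∈ gridIndices n a \ interiorIndices n a, roundingWeight a r y ≤ 1 := by
    rw [← sum_roundingWeight a y]
    exact Finset.sum_le_sum_of_subset_of_nonneg Finset.sdiff_subset
      fun r _ _ => roundingWeight_nonneg a r y
  have h2 : ∑ r ∈ gridIndices n a \ interiorIndices n a, roundingWeight a r y ≤
      4 / (a : ℝ) ^ 2 * ∑ i, (y i) ^ 2 := by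
    refine (Finset.sum_le_sum fun r hr => roundingWeight_boundary_le ha hr y).trans ?_
    rw [← Finset.sum_mul]
    exact mul_le_of_le_one_left (by positivity) h1
  calc _ ≤ heatedDensity n σ μ y * (4 / (a : ℝ) ^ 2 * ∑ i, (y i) ^ 2) :=
        mul_le_mul_of_nonneg_left h2 (heatedDensity_nonneg y)
    _ = _ := by ring

/-- The grid points on the boundary of the cube contribute negligibly to the entropy. -/
lemma tendsto_boundary (hσ : 0 < σ)
    (hvar : Integrable (fun x : Fin n → ℝ => ∑ i, (x i) ^ 2) μ) :
    Tendsto (fun a : ℕ =>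
      (∑ r ∈ gridIndices n a \ interiorIndices n a, negMulLog (discProbVec n σ a μ r)) -
        n * Real.log a * ∑ r ∈ gridIndices n a \ interiorIndices n a, discProbVec n σ a μ r)
      atTop (nhds 0) := by
  set M := ∫ y, heatedDensity n σ μ y * ∑ i, (y i) ^ 2
  have hM : 0 ≤ M := integral_nonneg fun y => mul_nonneg (heatedDensity_nonneg y) (by positivity)
  have hlim : Tendsto (fun a : ℕ => (4 * M * (3 * n + 3) + 3 ^ n) / (a : ℝ)) atTop (nhds 0) :=
    tendsto_const_nhds.div_atTop tendsto_natCast_atTop_atTop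
  refine squeeze_zero_norm' ?_ hlim
  filter_upwards [eventually_ge_atTop 2] with a ha
  have ha' : (2 : ℝ) ≤ a := by exact_mod_cast ha
  have hlog0 : 0 ≤ Real.log a := Real.log_nonneg (by linarith)
  have hlog : Real.log a + 1 ≤ a := by
    linarith [Real.log_le_sub_one_of_pos (by linarith : (0 : ℝ) < a)]
  set B := gridIndices n a \ interiorIndices n a
  set q := ∑ r ∈ B, discProbVec n σ a μ r
  have hq0 : 0 ≤ q := Finset.sum_nonneg fun r _ => discProbVec_nonneg hσ hvar a r
  have hq : q ≤ 4 / (a : ℝ) ^ 2 * M := sum_discProbVec_boundary_le hσ hvar ha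
  have hexp : Real.exp (-((2 * n + 2) * Real.log a)) = ((a : ℝ) ^ (2 * n + 2))⁻¹ := by
    rw [Real.exp_neg, mul_comm, Real.exp_mul, Real.exp_log (by linarith)]
    exact_mod_cast rfl
  have hcard : (B.card : ℝ) ≤ 3 ^ n * (a : ℝ) ^ (2 * n) := by
    have h1 : B.card ≤ (2 * (a * a) + 1) ^ n :=
      (Finset.card_le_card Finset.sdiff_subset).trans (card_gridIndices n a).le
    have h2 : (2 * (a * a) + 1) ^ n ≤ (3 * a ^ 2) ^ n := Nat.pow_le_pow_left (by nlinarith) n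
    have h3 : (3 * a ^ 2) ^ n = 3 ^ n * a ^ (2 * n) := by rw [mul_pow, ← pow_mul]
    exact_mod_cast (h1.trans h2).trans h3.le
  have hent : |∑ r ∈ B, negMulLog (discProbVec n σ a μ r)| ≤
      q * (1 + (2 * n + 2) * Real.log a) + 3 ^ n / (a : ℝ) ^ 2 := by
    calc |∑ r ∈ B, negMulLog (discProbVec n σ a μ r)|
        ≤ ∑ r ∈ B, (discProbVec n σ a μ r * (1 + (2 * n + 2) * Real.log a) +
            Real.exp (-((2 * n + 2) * Real.log a))) :=
          (Finset.abs_sum_le_sum_abs _ _).trans (Finset.sum_le_sum fun r _ =>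
            abs_negMulLog_le (discProbVec_nonneg hσ hvar a r) (discProbVec_le_one hσ hvar a r)
              (by positivity))
      _ = q * (1 + (2 * n + 2) * Real.log a) + B.card * ((a : ℝ) ^ (2 * n + 2))⁻¹ := by
          rw [Finset.sum_add_distrib, ← Finset.sum_mul, hexp, Finset.sum_const, nsmul_eq_mul]
      _ ≤ q * (1 + (2 * n + 2) * Real.log a) +
            3 ^ n * (a : ℝ) ^ (2 * n) * ((a : ℝ) ^ (2 * n + 2))⁻¹ := by gcongr
      _ = _ := by
          congr 1
          rw [pow_add]
          field_simp
  rw [Real.norm_eq_abs]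
  calc _ ≤ |∑ r ∈ B, negMulLog (discProbVec n σ a μ r)| + |n * Real.log a * q| := abs_sub _ _
    _ ≤ (q * (1 + (2 * n + 2) * Real.log a) + 3 ^ n / (a : ℝ) ^ 2) + n * Real.log a * q := by
        rw [abs_of_nonneg (by positivity : 0 ≤ n * Real.log a * q)]
        gcongr
    _ = q * (1 + (3 * n + 2) * Real.log a) + 3 ^ n / (a : ℝ) ^ 2 := by ring
    _ ≤ (4 / (a : ℝ) ^ 2 * M) * ((3 * n + 3) * a) + 3 ^ n / (a : ℝ) := by
        gcongr
        · nlinarith [(n.cast_nonneg : (0 : ℝ) ≤ n)]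
        · nlinarith
    _ = _ := by
        field_simp

/-- The grid points inside the cube contribute a Riemann sum of the differential entropy. -/
lemma tendsto_interior (hσ : 0 < σ)
    (hvar : Integrable (fun x : Fin n → ℝ => ∑ i, (x i) ^ 2) μ) :
    Tendsto (fun a : ℕ => ((a : ℝ) ^ n)⁻¹ *
      ∑ r ∈ interiorIndices n a, negMulLog (tentAverage (heatedDensity n σ μ) a r))
      atTop (nhds (∫ y, negMulLog (heatedDensity n σ μ y))) := by
  set f := heatedDensity n σ μ
  set c : ℝ := 1 / (2 * σ ^ 2)
  have hc : 0 < c := by positivity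
  set C : ℝ := (2 * π * σ ^ 2) ^ (-(n : ℝ) / 2)
  have hC : 0 ≤ C := by positivity
  set D : ℝ := C * Real.exp (c * (n * 4))
  have hD : 0 ≤ D := by positivity
  have hf0 : ∀ y, 0 ≤ f y := heatedDensity_nonneg
  have hfc : Continuous f := continuous_heatedDensity
  have hfC : ∀ y, |f y| ≤ C := fun y => by
    rw [abs_of_nonneg (hf0 y), show f y = _ from heatedDensity_eq y]
    exact mul_le_of_le_one_right hC (gaussSmoothing_le_one (μ := μ) hc.le y)
  have hfD : ∀ y z : Fin n → ℝ, (∀ i, |z i - y i| ≤ 2) →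
      f z ≤ D * gaussSmoothing n (c / 2) μ y := fun y z h => by
    rw [show f z = C * gaussSmoothing n c μ z from heatedDensity_eq z, mul_assoc C]
    exact mul_le_mul_of_nonneg_left (gaussSmoothing_le_of_near (μ := μ) hc h) hC
  have hg0 : ∀ y, 0 ≤ gaussSmoothing n (c / 2) μ y := gaussSmoothing_nonneg
  set Φ : ℕ → (Fin n → ℝ) → ℝ := fun a y => ∑ r ∈ interiorIndices n a,
    if (fun i => ⌊(a : ℝ) * y i⌋) = r then negMulLog (tentAverage f a r) else 0
  have hmain : Tendsto (fun a : ℕ => ∫ y, Φ a y) atTop (nhds (∫ y, negMulLog (f y))) := by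
    refine tendsto_integral_filter_of_dominated_convergence
      (fun y => D * (gaussSmoothing n (c / 2) μ y * (D + ∑ i, (y i) ^ 2)) + gaussKernel n 1 y)
      ?_ ?_ ?_ ?_
    · filter_upwards [eventually_gt_atTop 0] with a ha
      refine (Finset.measurable_sum _ fun r _ => ?_).aestronglyMeasurable
      refine Measurable.ite ?_ measurable_const measurable_const
      rw [setOf_floor_eq ha]
      exact MeasurableSet.univ_pi fun i => measurableSet_Ico
    · filter_upwards [eventually_gt_atTop 0] with a ha
      refine ae_of_all _ fun y => ?_
      have hS : 0 ≤ ∑ i, (y i) ^ 2 := by positivity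
      simp only [Φ, Finset.sum_ite_eq]
      split_ifs
      · have h1 : tentAverage f a (fun i => ⌊(a : ℝ) * y i⌋) ≤
            D * gaussSmoothing n (c / 2) μ y :=
          tentAverage_le hf0 ha (fun i => abs_floor_sub_le _) (hfD y)
        have h2 := h1.trans (mul_le_of_le_one_right hD
          (gaussSmoothing_le_one (μ := μ) (half_pos hc).le y))
        refine (abs_negMulLog_le (tentAverage_nonneg hf0 _ _) h2 hS).trans ?_
        rw [gaussKernel, one_mul, ← mul_assoc]
        gcongr
      · rw [norm_zero]
        have := hg0 y
        have := gaussKernel_pos 1 y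
        positivity
    · exact ((integrable_gaussSmoothing_mul (half_pos hc) hvar D).const_mul D).add
        (integrable_gaussKernel one_pos)
    · refine ae_of_all _ fun y => ?_
      refine ((continuous_negMulLog.tendsto _).comp (tendsto_tentAverage hfc hfC y)).congr' ?_
      filter_upwards [eventually_floor_mem_interiorIndices y] with a ha
      simp only [Φ, Finset.sum_ite_eq, if_pos ha, Function.comp]
  refine hmain.congr' ?_
  filter_upwards [eventually_gt_atTop 0] with a ha
  exact integral_comp_floor ha _ _

lemma tsum_negMulLog_discProbVec (hσ : 0 < σ)
    (hvar : Integrable (fun x : Fin n → ℝ => ∑ i, (x i) ^ 2) μ) {a : ℕ} (ha : 0 < a) :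
    (∑' r : Fin n → ℤ, negMulLog (discProbVec n σ a μ r)) - n * Real.log a =
      ((a : ℝ) ^ n)⁻¹ *
          (∑ r ∈ interiorIndices n a, negMulLog (tentAverage (heatedDensity n σ μ) a r)) +
        ((∑ r ∈ gridIndices n a \ interiorIndices n a, negMulLog (discProbVec n σ a μ r)) -
          n * Real.log a * ∑ r ∈ gridIndices n a \ interiorIndices n a, discProbVec n σ a μ r) := by
  rw [tsum_eq_sum (s := gridIndices n a) fun r hr => by
    rw [discProbVec_eq_zero hσ hvar hr, negMulLog_zero]]
  have hsum := sum_discProbVec_gridIndices hσ hvar a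
  rw [← Finset.sum_sdiff (interiorIndices_subset n a)] at hsum ⊢
  have h_interior : ∑ r ∈ interiorIndices n a, negMulLog (discProbVec n σ a μ r) =
      n * Real.log a * (∑ r ∈ interiorIndices n a, discProbVec n σ a μ r) + ((a : ℝ) ^ n)⁻¹ *
        ∑ r ∈ interiorIndices n a, negMulLog (tentAverage (heatedDensity n σ μ) a r) := by
    rw [Finset.mul_sum, Finset.mul_sum, ← Finset.sum_add_distrib]
    refine Finset.sum_congr rfl fun r hr => ?_
    rw [discProbVec_interior hσ hvar ha hr, negMulLog_mul]
    simp only [negMulLog, Real.log_inv, Real.log_pow]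
    ring
  rw [h_interior]
  linear_combination n * Real.log a * hsum

end DiscretizedEntropy

/-- For a random vector `X` in `ℝⁿ` with finite second moment,
`H(t^n_{σ,a}(X)) = n log a + D(X + σM) + o(1)` as `a → ∞`, where `H` is Shannon entropy
of the discretized distribution and `D` is differential entropy. -/
theorem discretized_entropy_vector_limit
    (n : ℕ) (σ : ℝ) (hσ : 0 < σ) (μ : Measure (Fin n → ℝ)) [IsProbabilityMeasure μ]
    (hvar : Integrable (fun x => ∑ i, (x i) ^ 2) μ) :
    Tendsto (fun a : ℕ =>
        (∑' r : Fin n → ℤ, Real.negMulLog (discProbVec n σ a μ r)) - n * Real.log a)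
      atTop (nhds (∫ y, Real.negMulLog (heatedDensity n σ μ y))) := by
  rw [← add_zero (∫ y, Real.negMulLog (heatedDensity n σ μ y))]
  refine ((tendsto_interior hσ hvar).add (tendsto_boundary hσ hvar)).congr' ?_
  filter_upwards [eventually_gt_atTop 0] with a ha
  exact (tsum_negMulLog_discProbVec hσ hvar ha).symm
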